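/- For every n ≥ 2, 1 ≤ i ≤ n−1 and 1 ≤ j ≤ n, the braid operators act on the vectors l_j by: t_i(l_j) = −q²·l_i if i = j, t_i(l_j) = q·l_i + l_j if |i−j| = 1, t_i(l_j) = l_j if |i−j| > 1; and t_i′(l_j) = −q⁻²·l_i if i = j, t_i′(l_j) = q⁻¹·l_i + l_j if |i−j| = 1, t_i′(l_j) = l_j if |i−j| > 1. In particular the span of l_1, …, l_n is invariant under every t_i and t_i′ (yielding the Burau representation). -/

import Mathlib

set_option maxHeartbeats 1000000
set_option synthInstance.maxHeartbeats 400000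

/-! Common setup: `Fq = ℚ(q)`, the tensor power `V^{⊗n}` of `V = Fq²` realized as
functions on the set of `{0,1}`-sequences (its standard basis), the Temperley-Lieb
and braid operators `U_i, t_i, t_i'`, the quantum `sl₂` operators `E, F, K^{⊗n}`,
weight spaces, quantum integers and the Jones-Wenzl operators. -/

noncomputable section

/-- The field `ℚ(q)` of rational functions. -/
abbrev Fq := RatFunc ℚ

/-- The variable `q`. -/
def q : Fq := RatFunc.X

/-- `V^{⊗n}` for `V = Fq²`: functions on the index set of the standard basis
`v_{i₁} ⊗ ⋯ ⊗ v_{iₙ}`, `i_r ∈ {0,1}` (here `false ↔ v₀`, `true ↔ v₁`). -/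
abbrev Tens (n : ℕ) := (Fin n → Bool) → Fq

/-- Coefficients of `Ũ` on `V ⊗ V`: `uCoef a b c d` is the coefficient of
`v_c ⊗ v_d` in `Ũ(v_a ⊗ v_b)`. -/
def uCoef : Bool → Bool → Bool → Bool → Fq
  | false, true, true, false => 1
  | false, true, false, true => -q
  | true, false, true, false => -q⁻¹
  | true, false, false, true => 1
  | _, _, _, _ => 0

/-- Coefficients of `t̃` on `V ⊗ V`. -/
def tCoef : Bool → Bool → Bool → Bool → Fq
  | false, false, false, false => 1
  | true, true, true, true => 1
  | false, true, true, false => q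
  | false, true, false, true => 1 - q ^ 2
  | true, false, false, true => q
  | _, _, _, _ => 0

/-- Coefficients of `t̃′` on `V ⊗ V`. -/
def tpCoef : Bool → Bool → Bool → Bool → Fq
  | false, false, false, false => 1
  | true, true, true, true => 1
  | false, true, true, false => q⁻¹
  | true, false, true, false => 1 - (q ^ 2)⁻¹
  | true, false, false, true => q⁻¹
  | _, _, _, _ => 0

/-- Matrix of the operator `id^{⊗(i-1)} ⊗ T ⊗ id^{⊗(n-i-1)}` acting on the
(1-based) tensor factors `i, i+1` of `V^{⊗n}`, where `T` has coefficient matrix `m`: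
the `(t, s)` entry is the coefficient of the basis vector indexed by `t` in the image
of the basis vector indexed by `s`. -/
def locMat (n : ℕ) (m : Bool → Bool → Bool → Bool → Fq) (i : ℕ) :
    Matrix (Fin n → Bool) (Fin n → Bool) Fq := fun t s =>
  if h : 1 ≤ i ∧ i < n then
    let i0 : Fin n := ⟨i - 1, by omega⟩
    let i1 : Fin n := ⟨i, by omega⟩
    if s = Function.update (Function.update t i0 (s i0)) i1 (s i1) then
      m (s i0) (s i1) (t i0) (t i1)
    else 0
  else 0

/-- The Temperley-Lieb operator `U_i = id^{⊗(i-1)} ⊗ Ũ ⊗ id^{⊗(n-i-1)}` (1-based `i`). -/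
def Uop (n i : ℕ) : Module.End Fq (Tens n) := (locMat n uCoef i).mulVecLin

/-- The braid operator `t_i = id^{⊗(i-1)} ⊗ t̃ ⊗ id^{⊗(n-i-1)}` (1-based `i`). -/
def tOp (n i : ℕ) : Module.End Fq (Tens n) := (locMat n tCoef i).mulVecLin

/-- The inverse braid operator `t_i′ = id^{⊗(i-1)} ⊗ t̃′ ⊗ id^{⊗(n-i-1)}` (1-based `i`). -/
def tpOp (n i : ℕ) : Module.End Fq (Tens n) := (locMat n tpCoef i).mulVecLin

/-- Number of indices `r` with `i_r = 1` in the basis index `s`. -/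
def countOnes {n : ℕ} (s : Fin n → Bool) : ℕ := (Finset.univ.filter fun r => s r = true).card

/-- The weight space `W_k = V₁^{⊗n}[-n+2k]`: the span of the standard basis vectors
with exactly `k` of the `i_r` equal to `1`. -/
def weightSpace (n k : ℕ) : Submodule Fq (Tens n) :=
  Submodule.span Fq {ψ : Tens n | ∃ s : Fin n → Bool, countOnes s = k ∧ ψ = Pi.single s 1}

/-- Eigenvalue of `K` on `v_b`. -/
def kval (b : Bool) : Fq := if b then q else q⁻¹

/-- Matrix of `E = Σ_j K^{⊗(j-1)} ⊗ e ⊗ id^{⊗(n-j)}` on `V^{⊗n}`. -/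
def Emat (n : ℕ) : Matrix (Fin n → Bool) (Fin n → Bool) Fq := fun t s =>
  ∑ j : Fin n,
    if s j = false ∧ t = Function.update s j true then
      ∏ r ∈ Finset.univ.filter fun r => r < j, kval (s r)
    else 0

/-- Matrix of `F = Σ_j id^{⊗(j-1)} ⊗ f ⊗ (K⁻¹)^{⊗(n-j)}` on `V^{⊗n}`. -/
def Fmat (n : ℕ) : Matrix (Fin n → Bool) (Fin n → Bool) Fq := fun t s =>
  ∑ j : Fin n,
    if s j = true ∧ t = Function.update s j false then
      ∏ r ∈ Finset.univ.filter fun r => j < r, (kval (s r))⁻¹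
    else 0

/-- The operator `E` on `V^{⊗n}`. -/
def Eop (n : ℕ) : Module.End Fq (Tens n) := (Emat n).mulVecLin

/-- The operator `F` on `V^{⊗n}`. -/
def Fop (n : ℕ) : Module.End Fq (Tens n) := (Fmat n).mulVecLin

/-- The operator `𝐊 = K^{⊗n}` on `V^{⊗n}`. -/
def Kop (n : ℕ) : Module.End Fq (Tens n) :=
  (Matrix.diagonal fun s : Fin n → Bool => ∏ r, kval (s r)).mulVecLin

/-- The operator `𝐊⁻¹ = (K⁻¹)^{⊗n}` on `V^{⊗n}`. -/
def Kinvop (n : ℕ) : Module.End Fq (Tens n) :=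
  (Matrix.diagonal fun s : Fin n → Bool => (∏ r, kval (s r))⁻¹).mulVecLin

/-- The quantum integer `[m] = (q^m - q^{-m})/(q - q⁻¹)`. -/
def qint (m : ℕ) : Fq := (q ^ m - q⁻¹ ^ m) / (q - q⁻¹)

/-- The quantum factorial `[m]! = [1][2]⋯[m]`. -/
def qfact (m : ℕ) : Fq := ∏ i ∈ Finset.range m, qint (i + 1)

/-- The quantum binomial coefficient `[n choose k] = [n]!/([k]!·[n-k]!)`. -/
def qbinom (n k : ℕ) : Fq := qfact n / (qfact k * qfact (n - k))

/-- The divided power `E^{(k)} = E^k/[k]!`. -/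
def Ediv (n k : ℕ) : Module.End Fq (Tens n) := (qfact k)⁻¹ • (Eop n) ^ k

/-- The divided power `F^{(k)} = F^k/[k]!`. -/
def Fdiv (n k : ℕ) : Module.End Fq (Tens n) := (qfact k)⁻¹ • (Fop n) ^ k

/-- The operator `P_k = (1/[n choose k])·E^{(k)} ∘ F^{(k)}` (the Jones-Wenzl projector
on the weight space `W_k`). -/
def JW (n k : ℕ) : Module.End Fq (Tens n) := (qbinom n k)⁻¹ • (Ediv n k ∘ₗ Fdiv n k)

/-- The vectors `l_r` (1-based): `l_r = v₀^{⊗(r-1)} ⊗ (v₁⊗v₀ - q·v₀⊗v₁) ⊗ v₀^{⊗(n-r-1)}`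
for `r ≠ n`, and `l_n = v₀^{⊗(n-1)} ⊗ v₁`. -/
def ell (n j : ℕ) : Tens n :=
  if j = n then Pi.single (fun r => decide (r.val = n - 1)) 1
  else (Pi.single (fun r => decide (r.val = j - 1)) 1 : Tens n)
      - q • (Pi.single (fun r => decide (r.val = j)) 1 : Tens n)

/-- The span of `l_1, …, l_n`. -/
def ellSpan (n : ℕ) : Submodule Fq (Tens n) :=
  Submodule.span Fq {v : Tens n | ∃ j, 1 ≤ j ∧ j ≤ n ∧ v = ell n j}

/-- The standard basis vector with `v₁` in the (0-based) tensor position `k` and `v₀` in all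
other positions. -/
def oneAt (n k : ℕ) : Tens n := Pi.single (fun r => decide (r.val = k)) 1

lemma ell_of_ne {n j : ℕ} (h : j ≠ n) : ell n j = oneAt n (j - 1) - q • oneAt n j := by
  simp [ell, oneAt, h]

lemma ell_self (n : ℕ) : ell n n = oneAt n (n - 1) := by
  simp [ell, oneAt]

lemma q_ne_zero : q ≠ 0 := RatFunc.X_ne_zero

/-- A local operator expands a standard basis vector by changing only the two entries it acts
on. -/
lemma locMat_mulVecLin_single {n i : ℕ} (m : Bool → Bool → Bool → Bool → Fq) (hi : i + 1 < n)
    (s : Fin n → Bool) :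
    (locMat n m (i + 1)).mulVecLin (Pi.single s 1) =
      ∑ c : Bool, ∑ d : Bool, m (s ⟨i, by omega⟩) (s ⟨i + 1, hi⟩) c d •
        (Pi.single (Function.update (Function.update s ⟨i, by omega⟩ c) ⟨i + 1, hi⟩ d) 1 :
          Tens n) := by
  have key : ∀ (t : Fin n → Bool) (c d : Bool),
      t = Function.update (Function.update s ⟨i, by omega⟩ c) ⟨i + 1, hi⟩ d ↔
        (s = Function.update (Function.update t ⟨i, by omega⟩ (s ⟨i, by omega⟩)) ⟨i + 1, hi⟩
          (s ⟨i + 1, hi⟩)) ∧ t ⟨i, by omega⟩ = c ∧ t ⟨i + 1, hi⟩ = d := by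
    intro t c d
    constructor
    · rintro rfl
      refine ⟨?_, by simp, by simp⟩
      ext r
      by_cases h1 : r = ⟨i + 1, hi⟩
      · subst h1; simp
      by_cases h0 : r = ⟨i, by omega⟩
      · subst h0; simp
      simp [Function.update_of_ne h1, Function.update_of_ne h0]
    · rintro ⟨h, rfl, rfl⟩
      ext r
      by_cases h1 : r = ⟨i + 1, hi⟩
      · subst h1; simp
      by_cases h0 : r = ⟨i, by omega⟩
      · subst h0; simp
      have := congrFun h r
      simp only [Function.update_of_ne h1, Function.update_of_ne h0] at this ⊢
      rw [this]
  ext t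
  have hcond : 1 ≤ i + 1 ∧ i + 1 < n := ⟨by omega, hi⟩
  simp only [Matrix.mulVecLin_apply, Matrix.mulVec_single_one, Matrix.col_apply, locMat,
    dif_pos hcond, Nat.add_sub_cancel, Finset.sum_apply, Pi.smul_apply, Pi.single_apply, key,
    smul_eq_mul]
  by_cases h : s = Function.update (Function.update t ⟨i, by omega⟩ (s ⟨i, by omega⟩))
      ⟨i + 1, hi⟩ (s ⟨i + 1, hi⟩)
  · simp only [eq_true h, if_true, true_and]
    cases t ⟨i, by omega⟩ <;> cases t ⟨i + 1, hi⟩ <;> simp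
  · simp only [eq_false h, false_and, if_false, mul_zero, Finset.sum_const_zero]

lemma locMat_oneAt_of_ne {n i k : ℕ} {m : Bool → Bool → Bool → Bool → Fq} (hi : i + 1 < n)
    (h00 : m false false false false = 1) (h01 : m false false false true = 0)
    (h10 : m false false true false = 0) (h11 : m false false true true = 0)
    (h0 : k ≠ i) (h1 : k ≠ i + 1) :
    (locMat n m (i + 1)).mulVecLin (oneAt n k) = oneAt n k := by
  rw [oneAt, locMat_mulVecLin_single m hi]
  simp only [h0.symm, h1.symm, decide_false, Fintype.sum_bool, h00, h01, h10, h11, zero_smul,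
    one_smul, zero_add]
  congr 1
  ext r
  simp only [Function.update_apply, Fin.ext_iff]
  grind

lemma locMat_oneAt_left {n i : ℕ} {m : Bool → Bool → Bool → Bool → Fq} (hi : i + 1 < n)
    (h00 : m true false false false = 0) (h11 : m true false true true = 0) :
    (locMat n m (i + 1)).mulVecLin (oneAt n i) =
      m true false true false • oneAt n i + m true false false true • oneAt n (i + 1) := by
  rw [oneAt, locMat_mulVecLin_single m hi]
  simp only [Nat.succ_ne_self, decide_false, decide_true, Fintype.sum_bool, h00, h11, zero_smul,
    zero_add, add_zero, oneAt]
  congr 3 <;> ext r <;> simp only [Function.update_apply, Fin.ext_iff] <;> grind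

lemma locMat_oneAt_right {n i : ℕ} {m : Bool → Bool → Bool → Bool → Fq} (hi : i + 1 < n)
    (h00 : m false true false false = 0) (h11 : m false true true true = 0) :
    (locMat n m (i + 1)).mulVecLin (oneAt n (i + 1)) =
      m false true true false • oneAt n i + m false true false true • oneAt n (i + 1) := by
  rw [oneAt, locMat_mulVecLin_single m hi]
  simp only [(Nat.succ_ne_self i).symm, decide_false, decide_true, Fintype.sum_bool, h00, h11,
    zero_smul, zero_add, add_zero, oneAt]
  congr 3 <;> ext r <;> simp only [Function.update_apply, Fin.ext_iff] <;> grind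

/-- The action on the vectors `oneAt n k` shared by `t_{i+1}` (for `a = q`) and `t_{i+1}′`
(for `a = q⁻¹`). -/
structure IsBurauAction (n i : ℕ) (a : Fq) (T : Module.End Fq (Tens n)) : Prop where
  left : T (oneAt n i) = (1 - a * q⁻¹) • oneAt n i + a • oneAt n (i + 1)
  right : T (oneAt n (i + 1)) = a • oneAt n i + (1 - a * q) • oneAt n (i + 1)
  of_ne : ∀ k, k ≠ i → k ≠ i + 1 → T (oneAt n k) = oneAt n k

lemma isBurauAction_tOp {n i : ℕ} (hi : i + 1 < n) : IsBurauAction n i q (tOp n (i + 1)) where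
  left := by
    rw [tOp, locMat_oneAt_left hi rfl rfl]
    simp [tCoef, q_ne_zero]
  right := by
    rw [tOp, locMat_oneAt_right hi rfl rfl]
    simp [tCoef, pow_two]
  of_ne _ h0 h1 := locMat_oneAt_of_ne hi rfl rfl rfl rfl h0 h1

lemma isBurauAction_tpOp {n i : ℕ} (hi : i + 1 < n) :
    IsBurauAction n i q⁻¹ (tpOp n (i + 1)) where
  left := by
    rw [tpOp, locMat_oneAt_left hi rfl rfl]
    simp [tpCoef, pow_two]
  right := by
    rw [tpOp, locMat_oneAt_right hi rfl rfl]
    simp [tpCoef, q_ne_zero]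
  of_ne _ h0 h1 := locMat_oneAt_of_ne hi rfl rfl rfl rfl h0 h1

namespace IsBurauAction

variable {n i : ℕ} {a : Fq} {T : Module.End Fq (Tens n)}

lemma map_ell_self (hT : IsBurauAction n i a T) (hi : i + 1 < n) (ha : a = q ∨ a = q⁻¹) :
    T (ell n (i + 1)) = (-(a ^ 2)) • ell n (i + 1) := by
  have hq := q_ne_zero
  rw [ell_of_ne hi.ne, Nat.add_sub_cancel, map_sub, map_smul, hT.left, hT.right]
  rcases ha with rfl | rfl
  all_goals
    ext s
    simp only [Pi.add_apply, Pi.sub_apply, Pi.smul_apply, smul_eq_mul]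
    field_simp
    ring

lemma map_ell_succ (hT : IsBurauAction n i a T) (hi : i + 1 < n) :
    T (ell n (i + 2)) = a • ell n (i + 1) + ell n (i + 2) := by
  rw [ell_of_ne hi.ne, Nat.add_sub_cancel]
  rcases eq_or_ne (i + 2) n with rfl | h
  · rw [ell_self, show i + 2 - 1 = i + 1 from rfl, hT.right]
    ext s
    simp only [Pi.add_apply, Pi.sub_apply, Pi.smul_apply, smul_eq_mul]
    ring
  · rw [ell_of_ne h, show i + 2 - 1 = i + 1 from rfl, map_sub, map_smul, hT.right,
      hT.of_ne (i + 2) (by omega) (by omega)]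
    ext s
    simp only [Pi.add_apply, Pi.sub_apply, Pi.smul_apply, smul_eq_mul]
    ring

lemma map_ell_pred (hT : IsBurauAction n i a T) (hi : i + 1 < n) (h : 1 ≤ i) :
    T (ell n i) = a • ell n (i + 1) + ell n i := by
  have hq := q_ne_zero
  rw [ell_of_ne hi.ne, Nat.add_sub_cancel, ell_of_ne (by omega : i ≠ n), map_sub, map_smul,
    hT.left, hT.of_ne (i - 1) (by omega) (by omega)]
  ext s
  simp only [Pi.add_apply, Pi.sub_apply, Pi.smul_apply, smul_eq_mul]
  field_simp
  ring

lemma map_ell_of_far (hT : IsBurauAction n i a T) {j : ℕ} (hj : 1 ≤ j)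
    (h : j < i ∨ i + 2 < j) : T (ell n j) = ell n j := by
  rcases eq_or_ne j n with rfl | hn
  · rw [ell_self, hT.of_ne _ (by omega) (by omega)]
  · rw [ell_of_ne hn, map_sub, map_smul, hT.of_ne _ (by omega) (by omega),
      hT.of_ne _ (by omega) (by omega)]

lemma map_ell_of_abs_eq_one (hT : IsBurauAction n i a T) (hi : i + 1 < n) {j : ℕ} (hj : 1 ≤ j)
    (h : |((i + 1 : ℕ) : ℤ) - (j : ℤ)| = 1) : T (ell n j) = a • ell n (i + 1) + ell n j := by
  obtain rfl | rfl : j = i ∨ j = i + 2 := by grind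
  · exact hT.map_ell_pred hi hj
  · exact hT.map_ell_succ hi

lemma map_ell_of_one_lt_abs (hT : IsBurauAction n i a T) {j : ℕ} (hj : 1 ≤ j)
    (h : 1 < |((i + 1 : ℕ) : ℤ) - (j : ℤ)|) : T (ell n j) = ell n j :=
  hT.map_ell_of_far hj (by grind)

lemma map_mem_ellSpan (hT : IsBurauAction n i a T) (hi : i + 1 < n) (ha : a = q ∨ a = q⁻¹) :
    ∀ ψ ∈ ellSpan n, T ψ ∈ ellSpan n := by
  have hmem : ∀ j, 1 ≤ j → j ≤ n → ell n j ∈ ellSpan n :=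
    fun j h1 h2 => Submodule.subset_span ⟨j, h1, h2, rfl⟩
  suffices ellSpan n ≤ (ellSpan n).comap T from this
  refine Submodule.span_le.mpr ?_
  rintro _ ⟨j, hj1, hj2, rfl⟩
  have hi' := hmem (i + 1) (by omega) hi.le
  have hj' := hmem j hj1 hj2
  change T (ell n j) ∈ ellSpan n
  rcases lt_trichotomy |((i + 1 : ℕ) : ℤ) - (j : ℤ)| 1 with h | h | h
  · obtain rfl : j = i + 1 := by grind
    rw [hT.map_ell_self hi ha]
    exact Submodule.smul_mem _ _ hi'
  · rw [hT.map_ell_of_abs_eq_one hi hj1 h]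
    exact Submodule.add_mem _ (Submodule.smul_mem _ _ hi') hj'
  · rwa [hT.map_ell_of_one_lt_abs hj1 h]

end IsBurauAction

/-- the action of the braid generators `t_i`, `t_i′` on the vectors
`l_j`; in particular the span of `l_1, …, l_n` is invariant under every `t_i`, `t_i′`
(the Burau representation). -/
theorem braid_on_ell (n : ℕ) (hn : 2 ≤ n) (i j : ℕ)
    (hi1 : 1 ≤ i) (hi2 : i ≤ n - 1) (hj1 : 1 ≤ j) (hj2 : j ≤ n) :
    (i = j → tOp n i (ell n j) = (-(q ^ 2)) • ell n i) ∧
    (|(i : ℤ) - (j : ℤ)| = 1 → tOp n i (ell n j) = q • ell n i + ell n j) ∧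
    (1 < |(i : ℤ) - (j : ℤ)| → tOp n i (ell n j) = ell n j) ∧
    (i = j → tpOp n i (ell n j) = (-(q ^ 2)⁻¹) • ell n i) ∧
    (|(i : ℤ) - (j : ℤ)| = 1 → tpOp n i (ell n j) = q⁻¹ • ell n i + ell n j) ∧
    (1 < |(i : ℤ) - (j : ℤ)| → tpOp n i (ell n j) = ell n j) ∧
    (∀ ψ ∈ ellSpan n, tOp n i ψ ∈ ellSpan n) ∧
    (∀ ψ ∈ ellSpan n, tpOp n i ψ ∈ ellSpan n) := by
  obtain ⟨i, rfl⟩ := Nat.exists_eq_add_of_le' hi1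
  have hi : i + 1 < n := by omega
  have ht := isBurauAction_tOp hi
  have htp := isBurauAction_tpOp hi
  refine ⟨?_, ht.map_ell_of_abs_eq_one hi hj1, ht.map_ell_of_one_lt_abs hj1, ?_,
    htp.map_ell_of_abs_eq_one hi hj1, htp.map_ell_of_one_lt_abs hj1,
    ht.map_mem_ellSpan hi (.inl rfl), htp.map_mem_ellSpan hi (.inr rfl)⟩
  · rintro rfl
    exact ht.map_ell_self hi (.inl rfl)
  · rintro rfl
    simpa only [inv_pow] using htp.map_ell_self hi (.inr rfl)
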